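/- arXiv:2602.15233 — 2 statements merged into one kernel-verified Lean document; each statement's English description precedes it below -/
import Mathlib

section
/- Let A be a finite nonempty set, Δ ≥ 0, and for t = 1, …, T let u^t : A → ℝ be payoff functions all taking values in a common interval of length Δ (i.e., there is m ∈ ℝ with m ≤ u^t(a) ≤ m + Δ for all t and a). Let the distributions p^t over A be produced by regret matching applied to u^1, u^2, …. Then max_{a ∈ A} (1/T) Σ_{t=1}^T (u^t(a) − Σ_{a' ∈ A} p^t(a') u^t(a')) ≤ Δ · |A| / √T. -/
theorem sq_max_zero_add_le (x y : ℝ) :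
    max 0 (x + y) ^ 2 ≤ max 0 x ^ 2 + 2 * (max 0 x * y) + y ^ 2 := by
  rcases max_cases 0 x with ⟨hx, _⟩ | ⟨hx, _⟩ <;>
    rcases max_cases 0 (x + y) with ⟨hxy, _⟩ | ⟨hxy, _⟩ <;> rw [hx, hxy] <;>
    nlinarith [sq_nonneg (x + y), sq_nonneg y]

/-- The payoffs' deviation from their average under a distribution is at most the length of an
interval containing them. -/
theorem abs_sub_expectation_le {A : Type*} [Fintype A] {m Δ : ℝ} {u p : A → ℝ}
    (hu : ∀ a, m ≤ u a ∧ u a ≤ m + Δ) (hp : ∀ a, 0 ≤ p a) (hp1 : ∑ a, p a = 1) (a : A) :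
    |u a - ∑ b, p b * u b| ≤ Δ := by
  have hl : m ≤ ∑ b, p b * u b := by
    calc m = ∑ b, p b * m := by rw [← Finset.sum_mul, hp1, one_mul]
      _ ≤ _ := Finset.sum_le_sum fun b _ => mul_le_mul_of_nonneg_left (hu b).1 (hp b)
  have hr : ∑ b, p b * u b ≤ m + Δ := by
    calc _ ≤ ∑ b, p b * (m + Δ) :=
          Finset.sum_le_sum fun b _ => mul_le_mul_of_nonneg_left (hu b).2 (hp b)
      _ = m + Δ := by rw [← Finset.sum_mul, hp1, one_mul]
  rw [abs_le]
  constructor <;> linarith [(hu a).1, (hu a).2]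

/-- A distribution proportional to the nonnegative weights `w` makes the weighted sum of
instantaneous regrets vanish. -/
theorem sum_mul_regret_eq_zero {A : Type*} [Fintype A] {w u p : A → ℝ}
    (hw : ∑ a, w a ≠ 0) (hp : ∀ a, p a = w a / ∑ b, w b) :
    ∑ a, w a * (u a - ∑ b, p b * u b) = 0 := by
  have h : (∑ a, w a) * ∑ b, p b * u b = ∑ b, w b * u b := by
    rw [Finset.mul_sum]
    refine Finset.sum_congr rfl fun b _ => ?_
    rw [hp b]
    field_simp
  simp only [mul_sub, Finset.sum_sub_distrib]
  rw [← Finset.sum_mul, h, sub_self]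

/-- regret-matching bound.  Let `A` be a finite nonempty set,
`Δ ≥ 0`, and let the payoff functions `u^t : A → ℝ` (t = 1, …, T) all take values
in a common interval `[m, m + Δ]`.  If the distributions `p^t` over `A` are produced
by regret matching applied to `u^1, u^2, …`, then the maximal average regret after
`T` steps is at most `Δ · |A| / √T`. -/
theorem regret_matching_bound
    {A : Type} [Fintype A] [DecidableEq A] [Nonempty A]
    (Δ m : ℝ) (hΔ : 0 ≤ Δ) (T : ℕ)
    (u p : ℕ → A → ℝ)
    (hrange : ∀ t ∈ Finset.Icc 1 T, ∀ a : A, m ≤ u t a ∧ u t a ≤ m + Δ)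
    -- regret matching: the initial distribution is uniform
    (hinit : ∀ a : A, p 1 a = 1 / (Fintype.card A : ℝ))
    -- regret matching step, case of some positive cumulative regret
    (hstep_pos : ∀ t : ℕ, 1 ≤ t → t < T →
      (∃ a' : A, 0 < ∑ s ∈ Finset.Icc 1 t, (u s a' - ∑ b : A, p s b * u s b)) →
      ∀ a : A, p (t + 1) a =
        max 0 (∑ s ∈ Finset.Icc 1 t, (u s a - ∑ b : A, p s b * u s b)) /
          ∑ a' : A, max 0 (∑ s ∈ Finset.Icc 1 t, (u s a' - ∑ b : A, p s b * u s b)))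
    -- regret matching step, case of no positive cumulative regret
    (hstep_zero : ∀ t : ℕ, 1 ≤ t → t < T →
      (¬ ∃ a' : A, 0 < ∑ s ∈ Finset.Icc 1 t, (u s a' - ∑ b : A, p s b * u s b)) →
      ∀ a : A, p (t + 1) a = 1 / (Fintype.card A : ℝ)) :
    Finset.univ.sup' Finset.univ_nonempty
        (fun a : A =>
          (1 / (T : ℝ)) * ∑ t ∈ Finset.Icc 1 T, (u t a - ∑ b : A, p t b * u t b))
      ≤ Δ * (Fintype.card A : ℝ) / Real.sqrt T := by
  set r : ℕ → A → ℝ := fun t a => u t a - ∑ b : A, p t b * u t b with hr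
  set R : ℕ → A → ℝ := fun t a => ∑ s ∈ Finset.Icc 1 t, r s a with hR
  change ∀ t : ℕ, 1 ≤ t → t < T → (∃ a', 0 < R t a') →
    ∀ a, p (t + 1) a = max 0 (R t a) / ∑ a', max 0 (R t a') at hstep_pos
  change ∀ t : ℕ, 1 ≤ t → t < T → (¬ ∃ a', 0 < R t a') →
    ∀ a, p (t + 1) a = 1 / (Fintype.card A : ℝ) at hstep_zero
  change Finset.univ.sup' Finset.univ_nonempty (fun a => (1 / (T : ℝ)) * R T a) ≤ _
  have hcard : (1 : ℝ) ≤ Fintype.card A := by exact_mod_cast Fintype.card_pos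
  have hS : ∀ t, (∃ a', 0 < R t a') → 0 < ∑ a', max 0 (R t a') := fun t ⟨a', ha'⟩ =>
    Finset.sum_pos' (fun _ _ => le_max_left _ _)
      ⟨a', Finset.mem_univ _, lt_max_of_lt_right ha'⟩
  have huniform : ∀ q : A → ℝ, (∀ a, q a = 1 / (Fintype.card A : ℝ)) →
      (∀ a, 0 ≤ q a) ∧ ∑ a, q a = 1 := by
    intro q hq
    refine ⟨fun a => by rw [hq a]; positivity, ?_⟩
    simp only [hq, Finset.sum_const, Finset.card_univ, nsmul_eq_mul]
    field_simp
  have hdist : ∀ t < T, (∀ a, 0 ≤ p (t + 1) a) ∧ ∑ a, p (t + 1) a = 1 := by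
    intro t ht
    rcases Nat.eq_zero_or_pos t with rfl | h1
    · exact huniform _ hinit
    by_cases h : ∃ a', 0 < R t a'
    · have hpos := hS t h
      refine ⟨fun a => ?_, ?_⟩
      · rw [hstep_pos t h1 ht h a]
        exact div_nonneg (le_max_left _ _) hpos.le
      · simp only [hstep_pos t h1 ht h]
        rw [← Finset.sum_div, div_self hpos.ne']
    · exact huniform _ (hstep_zero t h1 ht h)
  have horth : ∀ t < T, ∑ a, max 0 (R t a) * r (t + 1) a = 0 := by
    intro t ht
    by_cases h : ∃ a', 0 < R t a'
    · have h1 : 1 ≤ t := by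
        rcases Nat.eq_zero_or_pos t with rfl | h1
        · simp [hR] at h
        · exact h1
      exact sum_mul_regret_eq_zero (hS t h).ne' (hstep_pos t h1 ht h)
    · push Not at h
      exact Finset.sum_eq_zero fun a _ => by rw [max_eq_left (h a), zero_mul]
  have hpot : ∀ t ≤ T, ∑ a, max 0 (R t a) ^ 2 ≤ t * (Fintype.card A * Δ ^ 2) := by
    intro t
    induction t with
    | zero => simp [hR]
    | succ t ih =>
      intro ht
      obtain ⟨hp0, hp1⟩ := hdist t ht
      have hsucc : ∀ a, R (t + 1) a = R t a + r (t + 1) a := fun a =>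
        Finset.sum_Icc_succ_top (by omega) _
      have hsq : ∑ a, r (t + 1) a ^ 2 ≤ Fintype.card A * Δ ^ 2 := by
        rw [← nsmul_eq_mul]
        refine Finset.sum_le_card_nsmul _ _ _ fun a _ => ?_
        rw [← sq_abs]
        exact pow_le_pow_left₀ (abs_nonneg _) (abs_sub_expectation_le
          (hrange (t + 1) (Finset.mem_Icc.2 ⟨by omega, ht⟩)) hp0 hp1 a) 2
      calc ∑ a, max 0 (R (t + 1) a) ^ 2
          ≤ ∑ a, (max 0 (R t a) ^ 2 + 2 * (max 0 (R t a) * r (t + 1) a) + r (t + 1) a ^ 2) :=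
            Finset.sum_le_sum fun a _ => by rw [hsucc a]; exact sq_max_zero_add_le _ _
        _ = ∑ a, max 0 (R t a) ^ 2 + ∑ a, r (t + 1) a ^ 2 := by
            rw [Finset.sum_add_distrib, Finset.sum_add_distrib, ← Finset.mul_sum, horth t ht]
            ring
        _ ≤ t * (Fintype.card A * Δ ^ 2) + Fintype.card A * Δ ^ 2 :=
            add_le_add (ih (by omega)) hsq
        _ = _ := by push_cast; ring
  refine Finset.sup'_le _ _ fun a _ => ?_
  rcases Nat.eq_zero_or_pos T with rfl | hT
  · simp
  have hT' : (0 : ℝ) < T := by exact_mod_cast hT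
  have hsqrt : 0 < Real.sqrt T := Real.sqrt_pos.2 hT'
  have hss : Real.sqrt T ^ 2 = T := Real.sq_sqrt hT'.le
  have hbound : R T a ≤ Real.sqrt T * (Fintype.card A * Δ) := by
    refine (le_max_right 0 _).trans
      (pow_le_pow_iff_left₀ (le_max_left _ _) (by positivity) two_ne_zero |>.1 ?_)
    calc max 0 (R T a) ^ 2 ≤ ∑ a, max 0 (R T a) ^ 2 :=
          Finset.single_le_sum (f := fun a => max 0 (R T a) ^ 2)
            (fun _ _ => sq_nonneg _) (Finset.mem_univ a)
      _ ≤ T * (Fintype.card A * Δ ^ 2) := hpot T le_rfl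
      _ ≤ T * ((Fintype.card A : ℝ) ^ 2 * Δ ^ 2) := by
          gcongr
          exact le_self_pow₀ hcard two_ne_zero
      _ = (Real.sqrt T * (Fintype.card A * Δ)) ^ 2 := by rw [mul_pow, hss, mul_pow]
  calc 1 / (T : ℝ) * R T a ≤ 1 / (T : ℝ) * (Real.sqrt T * (Fintype.card A * Δ)) := by gcongr
    _ = Δ * Fintype.card A / Real.sqrt T := by
      rw [← hss, Real.sqrt_sq hsqrt.le]
      field_simp
end

section
/- For every behavioral strategy profile σ of a finite extensive-form game, there exist a belief system μ and a plausibility order ≾ on H such that ≾ rationalizes the assessment (σ, μ) — so (σ, μ) is AGM-consistent — and μ satisfies Bayes' rule at every information set reachable under σ: whenever r(I, σ) > 0, μ(h|I) = r(h, σ) / r(I, σ) for all h ∈ I. -/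
noncomputable section

open Finset

/-- A finite extensive-form game; nodes are histories (lists of edge labels).
The tree `H` is the finite, prefix-closed set `nodes`; the child of `h` via
edge-label `a` is `h ++ [a]`; a node is terminal iff its label set is empty. -/
structure EFG (Act : Type) [DecidableEq Act] where
  /-- the set `H` of histories/nodes of the game tree -/
  nodes : Finset (List Act)
  root_mem : ([] : List Act) ∈ nodes
  prefix_closed : ∀ (h : List Act) (a : Act), h ++ [a] ∈ nodes → h ∈ nodes
  /-- `V`, the acting player at a node (`0` is chance) -/
  player : List Act → ℕ
  /-- labels of the outgoing edges of a node (actions, resp. chance outcomes) -/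
  actions : List Act → Finset Act
  child_mem : ∀ h ∈ nodes, ∀ a ∈ actions h, h ++ [a] ∈ nodes
  mem_actions_of_child : ∀ h ∈ nodes, ∀ a : Act, h ++ [a] ∈ nodes → a ∈ actions h
  /-- `P(·|h)`: the chance distribution at chance nodes -/
  chance : List Act → Act → ℝ
  chance_pos : ∀ h ∈ nodes, actions h ≠ ∅ → player h = 0 → ∀ x ∈ actions h, 0 < chance h x
  chance_sums : ∀ h ∈ nodes, actions h ≠ ∅ → player h = 0 → ∑ a ∈ actions h, chance h a = 1
  /-- `I(h)`: the information set containing a (player) decision node -/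
  infoClass : List Act → Finset (List Act)
  mem_infoClass : ∀ h ∈ nodes, actions h ≠ ∅ → player h ≠ 0 → h ∈ infoClass h
  infoClass_spec : ∀ h ∈ nodes, actions h ≠ ∅ → player h ≠ 0 →
    ∀ h' ∈ infoClass h, h' ∈ nodes ∧ actions h' = actions h ∧ player h' = player h ∧
      infoClass h' = infoClass h
  /-- `u j z`: the utility of player `j` at terminal node `z` -/
  util : ℕ → List Act → ℝ

namespace EFG

variable {Act : Type} [DecidableEq Act]

/-- the set `Z` of terminal nodes -/
def terminals (G : EFG Act) : Finset (List Act) :=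
  G.nodes.filter fun z => G.actions z = ∅

/-- `I` is an information set of player `j` (i.e. `I ∈ I_j`) -/
def IsInfoset (G : EFG Act) (j : ℕ) (I : Finset (List Act)) : Prop :=
  ∃ h ∈ G.nodes, G.actions h ≠ ∅ ∧ G.player h = j ∧ G.infoClass h = I

/-- A behavioral strategy profile (it also records the chance probabilities,
so that `prob h a` is the probability of the edge `(h, h ++ [a])` for every node). -/
structure Strategy (G : EFG Act) where
  prob : List Act → Act → ℝ
  nonneg : ∀ h a, 0 ≤ prob h a
  sums_one : ∀ h ∈ G.nodes, G.actions h ≠ ∅ → ∑ a ∈ G.actions h, prob h a = 1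
  measurable : ∀ h ∈ G.nodes, G.actions h ≠ ∅ → G.player h ≠ 0 →
    ∀ h' ∈ G.infoClass h, prob h' = prob h
  chance_eq : ∀ h ∈ G.nodes, G.actions h ≠ ∅ → G.player h = 0 →
    ∀ a : Act, prob h a = G.chance h a

/-- the profile `σ` plays a pure strategy for player `j` -/
def IsPureFor (G : EFG Act) (σ : G.Strategy) (j : ℕ) : Prop :=
  ∀ h ∈ G.nodes, G.actions h ≠ ∅ → G.player h = j → ∃ a ∈ G.actions h, σ.prob h a = 1

/-- `τ = (τ_j, σ_{-j})`: `τ` agrees with `σ` at all decision nodes of players other than `j` -/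
def AgreesOff (G : EFG Act) (σ τ : G.Strategy) (j : ℕ) : Prop :=
  ∀ h ∈ G.nodes, G.actions h ≠ ∅ → G.player h ≠ j → τ.prob h = σ.prob h

/-- `σ' = σ|_{I → a}`: the profile equal to `σ` except that at `I` action `a`
is played with probability 1 -/
def IsDeviationAt (G : EFG Act) (σ σ' : G.Strategy) (I : Finset (List Act)) (a : Act) : Prop :=
  ∀ (h : List Act) (b : Act),
    σ'.prob h b = if h ∈ I then (if b = a then 1 else 0) else σ.prob h b

/-- a system of beliefs: a probability distribution over each information set -/
structure Belief (G : EFG Act) where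
  prob : List Act → ℝ
  nonneg : ∀ h, 0 ≤ prob h
  sums_one : ∀ h ∈ G.nodes, G.actions h ≠ ∅ → G.player h ≠ 0 →
    ∑ h' ∈ G.infoClass h, prob h' = 1

/-- product of edge probabilities along the path from `h` through the extension `s` -/
def suffixProb (G : EFG Act) (σ : G.Strategy) : List Act → List Act → ℝ
  | _, [] => 1
  | h, a :: s => σ.prob h a * suffixProb G σ (h ++ [a]) s

/-- reach probability `r(h, σ)` of a node from the root -/
def reach (G : EFG Act) (σ : G.Strategy) (h : List Act) : ℝ :=
  G.suffixProb σ [] h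

/-- conditional reach probability `r(h'|h,σ)` (zero if `h'` is not a successor of `h`) -/
def condReach (G : EFG Act) (σ : G.Strategy) (h h' : List Act) : ℝ :=
  if h <+: h' then G.suffixProb σ h (h'.drop h.length) else 0

/-- `Z ∩ Succ(h)`: terminal successors of `h` (including `h` itself if it is terminal) -/
def termSucc (G : EFG Act) (h : List Act) : Finset (List Act) :=
  G.nodes.filter fun z => G.actions z = ∅ ∧ h <+: z

/-- conditional expected utility `U^E(σ|h)` w.r.t. the terminal utility function `u` -/
def expUtil (G : EFG Act) (u : List Act → ℝ) (σ : G.Strategy) (h : List Act) : ℝ :=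
  ∑ z ∈ G.termSucc h, u z * G.condReach σ h z

/-- believed utility `U^B(σ, μ | I)` w.r.t. the terminal utility function `u` -/
def belUtil (G : EFG Act) (u : List Act → ℝ) (σ : G.Strategy) (μ : G.Belief)
    (I : Finset (List Act)) : ℝ :=
  ∑ h ∈ I, μ.prob h * G.expUtil u σ h

/-- `r^{σ,μ}(h'|I) = Σ_{h ∈ I} μ(h|I) r(h'|h,σ)` -/
def belReachNode (G : EFG Act) (σ : G.Strategy) (μ : G.Belief)
    (I : Finset (List Act)) (h' : List Act) : ℝ :=
  ∑ h ∈ I, μ.prob h * G.condReach σ h h'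

/-- `r^{σ,μ}(I'|I) = Σ_{h' ∈ I'} r^{σ,μ}(h'|I)` -/
def belReachSet (G : EFG Act) (σ : G.Strategy) (μ : G.Belief)
    (I I' : Finset (List Act)) : ℝ :=
  ∑ h' ∈ I', G.belReachNode σ μ I h'

/-- the information set `I'` (strictly) succeeds the information set `I` -/
def Succeeds (G : EFG Act) (I I' : Finset (List Act)) : Prop :=
  ∃ h ∈ I, ∃ h' ∈ I', h <+: h' ∧ h ≠ h'

/-- consistency of an assessment `(σ, μ)` in the sense of Hendon et al. -/
def Consistent (G : EFG Act) (σ : G.Strategy) (μ : G.Belief) : Prop :=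
  ∀ j : ℕ, 1 ≤ j → ∀ I I' : Finset (List Act),
    G.IsInfoset j I → G.IsInfoset j I' → G.Succeeds I I' →
    ∀ z ∈ G.nodes, G.actions z = ∅ → (∃ h' ∈ I', h' <+: z ∧ h' ≠ z) →
      G.belReachNode σ μ I z = G.belReachNode σ μ I' z * G.belReachSet σ μ I I'

/-- the sequence of (information set, action) pairs of player `j` along a history -/
def recordAux (G : EFG Act) (j : ℕ) : List Act → List Act → List (Finset (List Act) × Act)
  | _, [] => []
  | h, a :: s =>
      (if G.player h = j then [(G.infoClass h, a)] else []) ++ recordAux G j (h ++ [a]) s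

/-- perfect recall: any two nodes in the same information set of a player have the
same record of that player's past information sets and chosen actions -/
def PerfectRecall (G : EFG Act) : Prop :=
  ∀ h ∈ G.nodes, G.actions h ≠ ∅ → G.player h ≠ 0 →
    ∀ h' ∈ G.infoClass h,
      G.recordAux (G.player h) [] h = G.recordAux (G.player h) [] h'

/-- a plausibility order: a total preorder on the nodes satisfying the three
structural conditions of Bonanno -/
structure PlausOrder (G : EFG Act) where
  le : List Act → List Act → Prop
  refl : ∀ h, le h h
  trans : ∀ h₁ h₂ h₃, le h₁ h₂ → le h₂ h₃ → le h₁ h₃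
  total : ∀ h ∈ G.nodes, ∀ h' ∈ G.nodes, le h h' ∨ le h' h
  /-- (i) it is never the case that `ha ≺ h` -/
  child_not_lt : ∀ h ∈ G.nodes, G.actions h ≠ ∅ → ∀ a ∈ G.actions h,
    le (h ++ [a]) h → le h (h ++ [a])
  /-- (ii) every decision node has at least one action `a` with `ha ≾ h` … -/
  exists_le : ∀ h ∈ G.nodes, G.actions h ≠ ∅ → ∃ a ∈ G.actions h, le (h ++ [a]) h
  /-- … and any such `a` satisfies `h'a ≾ h'` for all `h'` in the information set of `h` -/
  info_le : ∀ h ∈ G.nodes, G.actions h ≠ ∅ → G.player h ≠ 0 → ∀ a ∈ G.actions h,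
    le (h ++ [a]) h → ∀ h' ∈ G.infoClass h, le (h' ++ [a]) h'
  /-- (iii) for every chance node `h` and outcome `x`, `hx ≾ h` -/
  chance_le : ∀ h ∈ G.nodes, G.actions h ≠ ∅ → G.player h = 0 → ∀ x ∈ G.actions h,
    le (h ++ [x]) h

/-- the plausibility order `P` rationalizes the assessment `(σ, μ)` (AGM-consistency) -/
def Rationalizes (G : EFG Act) (P : G.PlausOrder) (σ : G.Strategy) (μ : G.Belief) : Prop :=
  (∀ h ∈ G.nodes, G.actions h ≠ ∅ → G.player h ≠ 0 → ∀ a ∈ G.actions h,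
    (0 < σ.prob h a ↔ (P.le h (h ++ [a]) ∧ P.le (h ++ [a]) h))) ∧
  (∀ h ∈ G.nodes, G.actions h ≠ ∅ → G.player h = 0 → ∀ x ∈ G.actions h,
    (0 < G.chance h x ↔ (P.le h (h ++ [x]) ∧ P.le (h ++ [x]) h))) ∧
  (∀ h ∈ G.nodes, G.actions h ≠ ∅ → G.player h ≠ 0 →
    (0 < μ.prob h ↔ ∀ h' ∈ G.infoClass h, P.le h h'))

open Classical in
/-- number of probability-zero edges along the path from `h` through the extension `s` -/
def zeroCountAux (G : EFG Act) (σ : G.Strategy) : List Act → List Act → ℕ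
  | _, [] => 0
  | h, a :: s =>
      (if σ.prob h a = 0 then 1 else 0) + zeroCountAux G σ (h ++ [a]) s

/-- `k(h)`: the number of probability-zero edges on the path from the root to `h` -/
def zeroCount (G : EFG Act) (σ : G.Strategy) (h : List Act) : ℕ :=
  G.zeroCountAux σ [] h

end EFG

namespace EFG

variable {Act : Type} [DecidableEq Act] (G : EFG Act) (σ : G.Strategy)

lemma suffixProb_nonneg (h s : List Act) : 0 ≤ G.suffixProb σ h s := by
  induction s generalizing h with
  | nil => simp [suffixProb]
  | cons a s ih => exact mul_nonneg (σ.nonneg h a) (ih _)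

lemma suffixProb_pos_iff (h s : List Act) :
    0 < G.suffixProb σ h s ↔ G.zeroCountAux σ h s = 0 := by
  induction s generalizing h with
  | nil => simp [suffixProb, zeroCountAux]
  | cons a s ih =>
    have hn := σ.nonneg h a
    by_cases h0 : σ.prob h a = 0
    · simp [suffixProb, zeroCountAux, h0]
    · have hp : 0 < σ.prob h a := lt_of_le_of_ne hn (Ne.symm h0)
      simp [suffixProb, zeroCountAux, h0, mul_pos_iff_of_pos_left hp, ih]

lemma reach_nonneg (h : List Act) : 0 ≤ G.reach σ h :=
  G.suffixProb_nonneg σ [] h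

lemma reach_pos_iff (h : List Act) : 0 < G.reach σ h ↔ G.zeroCount σ h = 0 :=
  G.suffixProb_pos_iff σ [] h

open Classical in
lemma zeroCountAux_append_singleton (h s : List Act) (a : Act) :
    G.zeroCountAux σ h (s ++ [a]) =
      G.zeroCountAux σ h s + if σ.prob (h ++ s) a = 0 then 1 else 0 := by
  induction s generalizing h with
  | nil => simp [zeroCountAux]
  | cons b s ih => simp [zeroCountAux, ih, add_assoc]

open Classical in
lemma zeroCount_append_singleton (h : List Act) (a : Act) :
    G.zeroCount σ (h ++ [a]) = G.zeroCount σ h + if σ.prob h a = 0 then 1 else 0 :=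
  G.zeroCountAux_append_singleton σ [] h a

lemma zeroCount_le_append_singleton (h : List Act) (a : Act) :
    G.zeroCount σ h ≤ G.zeroCount σ (h ++ [a]) := by
  simp [zeroCount_append_singleton]

lemma zeroCount_append_singleton_le_iff (h : List Act) (a : Act) :
    G.zeroCount σ (h ++ [a]) ≤ G.zeroCount σ h ↔ 0 < σ.prob h a := by
  rw [zeroCount_append_singleton, (σ.nonneg h a).lt_iff_ne']
  split_ifs with h0 <;> simp [h0]

/-- The plausibility order comparing nodes by the number of probability-zero edges
leading to them. -/
def zeroCountOrder : G.PlausOrder where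
  le h h' := G.zeroCount σ h ≤ G.zeroCount σ h'
  refl _ := le_rfl
  trans _ _ _ := le_trans
  total _ _ _ _ := le_total _ _
  child_not_lt h _ _ a _ _ := G.zeroCount_le_append_singleton σ h a
  exists_le h hn hd := by
    obtain ⟨a, ha, hpos⟩ := Finset.exists_lt_of_sum_lt (s := G.actions h)
      (f := fun _ => (0 : ℝ)) (g := σ.prob h) (by simp [σ.sums_one h hn hd])
    exact ⟨a, ha, (G.zeroCount_append_singleton_le_iff σ h a).2 hpos⟩
  info_le h hn hd hp a _ hle h' hh' := by
    rw [zeroCount_append_singleton_le_iff] at hle ⊢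
    rwa [σ.measurable h hn hd hp h' hh']
  chance_le h hn hd hp x hx := by
    rw [zeroCount_append_singleton_le_iff, σ.chance_eq h hn hd hp]
    exact G.chance_pos h hn hd hp x hx

/-- The nodes of `I` reached through the fewest probability-zero edges. -/
def minZeroCount (I : Finset (List Act)) : Finset (List Act) :=
  I.filter fun h => ∀ h' ∈ I, G.zeroCount σ h ≤ G.zeroCount σ h'

open Classical in
/-- Bayesian beliefs on reachable sets, and uniform beliefs on the most plausible nodes of
unreachable ones. -/
def beliefWeight (I : Finset (List Act)) (h : List Act) : ℝ :=
  if 0 < ∑ h' ∈ I, G.reach σ h' then G.reach σ h / ∑ h' ∈ I, G.reach σ h'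
  else if h ∈ G.minZeroCount σ I then ((G.minZeroCount σ I).card : ℝ)⁻¹ else 0

lemma beliefWeight_nonneg (I : Finset (List Act)) (h : List Act) :
    0 ≤ G.beliefWeight σ I h := by
  unfold beliefWeight
  split_ifs with h1
  · exact div_nonneg (G.reach_nonneg σ h) h1.le
  · positivity
  · exact le_rfl

lemma minZeroCount_nonempty {I : Finset (List Act)} (hI : I.Nonempty) :
    (G.minZeroCount σ I).Nonempty := by
  obtain ⟨h, hh, hmin⟩ := Finset.exists_min_image I (G.zeroCount σ) hI
  exact ⟨h, Finset.mem_filter.2 ⟨hh, hmin⟩⟩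

lemma sum_beliefWeight {I : Finset (List Act)} (hI : I.Nonempty) :
    ∑ h ∈ I, G.beliefWeight σ I h = 1 := by
  unfold beliefWeight
  split_ifs with h1
  · rw [← Finset.sum_div, div_self h1.ne']
  · have hsub : G.minZeroCount σ I ⊆ I := Finset.filter_subset _ _
    have hne : ((G.minZeroCount σ I).card : ℝ) ≠ 0 :=
      Nat.cast_ne_zero.2 (G.minZeroCount_nonempty σ hI).card_pos.ne'
    rw [Finset.sum_ite_mem, Finset.inter_eq_right.2 hsub, Finset.sum_const, nsmul_eq_mul,
      mul_inv_cancel₀ hne]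

lemma beliefWeight_pos_iff {I : Finset (List Act)} {h : List Act} (hh : h ∈ I) :
    0 < G.beliefWeight σ I h ↔ ∀ h' ∈ I, G.zeroCount σ h ≤ G.zeroCount σ h' := by
  unfold beliefWeight
  split_ifs with h1 h2
  · obtain ⟨g, hg, hgpos⟩ := Finset.exists_lt_of_sum_lt (s := I)
      (f := fun _ => (0 : ℝ)) (g := G.reach σ) (by simpa using h1)
    rw [div_pos_iff_of_pos_right h1, reach_pos_iff]
    refine ⟨fun h0 h' _ => h0 ▸ Nat.zero_le _, fun hmin => ?_⟩
    exact Nat.le_zero.1 ((hmin g hg).trans_eq ((G.reach_pos_iff σ g).1 hgpos))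
  · have hpos : 0 < (G.minZeroCount σ I).card := Finset.card_pos.2 ⟨h, h2⟩
    exact iff_of_true (by positivity) (Finset.mem_filter.1 h2).2
  · exact iff_of_false (lt_irrefl _) fun hmin => h2 (Finset.mem_filter.2 ⟨hh, hmin⟩)

/-- The belief system assigning to each node its `beliefWeight` within its information set. -/
def plausibleBelief : G.Belief where
  prob h := G.beliefWeight σ (G.infoClass h) h
  nonneg _ := G.beliefWeight_nonneg σ _ _
  sums_one h hn hd hp := by
    rw [← G.sum_beliefWeight σ ⟨h, G.mem_infoClass h hn hd hp⟩]
    refine Finset.sum_congr rfl fun h' hh' => ?_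
    rw [(G.infoClass_spec h hn hd hp h' hh').2.2.2]

lemma zeroCountOrder_rationalizes :
    G.Rationalizes (G.zeroCountOrder σ) σ (G.plausibleBelief σ) := by
  have key (h : List Act) (a : Act) : 0 < σ.prob h a ↔
      ((G.zeroCountOrder σ).le h (h ++ [a]) ∧ (G.zeroCountOrder σ).le (h ++ [a]) h) := by
    rw [← zeroCount_append_singleton_le_iff]
    exact (and_iff_right (G.zeroCount_le_append_singleton σ h a)).symm
  refine ⟨fun h _ _ _ a _ => key h a, fun h hn hd hp x _ => ?_, fun h hn hd hp => ?_⟩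
  · rw [← σ.chance_eq h hn hd hp, key]
  · exact G.beliefWeight_pos_iff σ (G.mem_infoClass h hn hd hp)

end EFG

/-- For every behavioral strategy profile `σ` there exist a
belief system `μ` and a plausibility order `P` rationalizing `(σ, μ)` — so that
`(σ, μ)` is AGM-consistent — such that `μ` satisfies Bayes' rule at every
information set reachable under `σ`. -/
theorem exists_agm_consistent_bayesian_beliefs
    {Act : Type} [DecidableEq Act] (G : EFG Act) (σ : G.Strategy) :
    ∃ (μ : G.Belief) (P : G.PlausOrder), G.Rationalizes P σ μ ∧
      ∀ h ∈ G.nodes, G.actions h ≠ ∅ → G.player h ≠ 0 →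
        0 < ∑ h' ∈ G.infoClass h, G.reach σ h' →
        μ.prob h = G.reach σ h / ∑ h' ∈ G.infoClass h, G.reach σ h' := by
  exact ⟨G.plausibleBelief σ, G.zeroCountOrder σ, G.zeroCountOrder_rationalizes σ,
    fun _ _ _ _ hpos => if_pos hpos⟩
end
end
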